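/- arXiv:1209.3088 — 2 statements merged into one kernel-verified Lean document; each statement's English description precedes it below -/
import Mathlib

section
/- For every integer k ≥ 4 and every odd prime p, the rational number d(p,k) = ((2k³ − 9k² + 13k − 6)p³ + (180 − 120k)p + 360) · p(p⁴ − 1)(p² − 1) / 34560 is a positive integer; equivalently, 34560 = 2⁸·3³·5 divides ((2k³ − 9k² + 13k − 6)p³ + (180 − 120k)p + 360) · p(p⁴ − 1)(p² − 1), and this product is positive. -/
theorem six_dvd_weight_cubic (k : ℤ) : (6 : ℤ) ∣ 2 * k ^ 3 - 9 * k ^ 2 + 13 * k - 6 := by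
  refine (ZMod.intCast_zmod_eq_zero_iff_dvd _ 6).mp ?_
  push_cast
  generalize (k : ZMod 6) = x
  revert x
  decide

theorem five_dvd_level_factor (n : ℤ) : (5 : ℤ) ∣ n * (n ^ 4 - 1) * (n ^ 2 - 1) := by
  refine (ZMod.intCast_zmod_eq_zero_iff_dvd _ 5).mp ?_
  push_cast
  generalize (n : ZMod 5) = x
  revert x
  decide

theorem two_pow_seven_dvd_level_factor {n : ℤ} (hn : Odd n) :
    (128 : ℤ) ∣ n * (n ^ 4 - 1) * (n ^ 2 - 1) := by
  obtain ⟨t, ht⟩ := Int.eight_dvd_sq_sub_one_of_odd hn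
  rw [show n * (n ^ 4 - 1) * (n ^ 2 - 1) = n * (n ^ 2 - 1) ^ 2 * (n ^ 2 - 1 + 2) by ring, ht]
  exact ⟨n * t ^ 2 * (4 * t + 1), by ring⟩

/-- The numerator of the dimension formula is divisible by `34560` at every odd level. -/
theorem dvd_dim_numerator (k : ℤ) {n : ℤ} (hn : Odd n) :
    (34560 : ℤ) ∣
      ((2 * k ^ 3 - 9 * k ^ 2 + 13 * k - 6) * n ^ 3 + (180 - 120 * k) * n + 360) *
        (n * (n ^ 4 - 1) * (n ^ 2 - 1)) := by
  obtain ⟨a, ha⟩ := six_dvd_weight_cubic k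
  rw [ha]
  have h2 : (256 : ℤ) ∣ (6 * a * n ^ 3 + (180 - 120 * k) * n + 360) *
      (n * (n ^ 4 - 1) * (n ^ 2 - 1)) :=
    mul_dvd_mul (a := (2 : ℤ)) (c := 128)
      ⟨3 * a * n ^ 3 + (90 - 60 * k) * n + 180, by ring⟩ (two_pow_seven_dvd_level_factor hn)
  have h5 : (5 : ℤ) ∣ (6 * a * n ^ 3 + (180 - 120 * k) * n + 360) *
      (n * (n ^ 4 - 1) * (n ^ 2 - 1)) := (five_dvd_level_factor n).mul_left _
  have h3 : (27 : ℤ) ∣ (6 * a * n ^ 3 + (180 - 120 * k) * n + 360) *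
      (n * (n ^ 4 - 1) * (n ^ 2 - 1)) := by
    by_cases h : (3 : ℤ) ∣ n
    · obtain ⟨m, rfl⟩ := h
      exact mul_dvd_mul (a := (9 : ℤ)) (c := 3)
        ⟨18 * a * m ^ 3 + (60 - 40 * k) * m + 40, by ring⟩
        ⟨m * ((3 * m) ^ 4 - 1) * ((3 * m) ^ 2 - 1), by ring⟩
    · have hsq : (3 : ℤ) ∣ n ^ 2 - 1 := by
        replace h := mt (ZMod.intCast_zmod_eq_zero_iff_dvd n 3).mp h
        refine (ZMod.intCast_zmod_eq_zero_iff_dvd _ 3).mp ?_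
        push_cast
        generalize (n : ZMod 3) = x at h ⊢
        revert x
        decide
      obtain ⟨t, ht⟩ := hsq
      refine mul_dvd_mul (a := (3 : ℤ)) (c := 9)
        ⟨2 * a * n ^ 3 + (60 - 40 * k) * n + 120, by ring⟩ ?_
      rw [show n * (n ^ 4 - 1) * (n ^ 2 - 1) = n * (n ^ 2 - 1) ^ 2 * (n ^ 2 + 1) by ring, ht]
      exact ⟨n * t ^ 2 * (n ^ 2 + 1), by ring⟩
  generalize (6 * a * n ^ 3 + (180 - 120 * k) * n + 360) *
    (n * (n ^ 4 - 1) * (n ^ 2 - 1)) = x at *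
  omega

theorem dim_weight_factor_pos {k n : ℤ} (hk : 4 ≤ k) (hn : 3 ≤ n) :
    0 < (2 * k ^ 3 - 9 * k ^ 2 + 13 * k - 6) * n ^ 3 + (180 - 120 * k) * n + 360 := by
  obtain ⟨j, rfl⟩ := Int.le.dest hk
  have hj : (0 : ℤ) ≤ j := j.cast_nonneg
  generalize (j : ℤ) = i at hj ⊢
  obtain rfl | hn := hn.eq_or_lt
  · obtain rfl | hi := hj.eq_or_lt
    · norm_num
    · nlinarith [pow_pos hi 2, pow_pos hi 3]
  · have hcub : 30 + 37 * i ≤ 2 * (4 + i) ^ 3 - 9 * (4 + i) ^ 2 + 13 * (4 + i) - 6 := by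
      nlinarith [pow_nonneg hj 2, pow_nonneg hj 3]
    have hsq : 16 ≤ n ^ 2 := by nlinarith
    have hmul := mul_le_mul hcub hsq (by norm_num) (by linarith)
    nlinarith [mul_nonneg (show 0 ≤ n by linarith) (sub_nonneg.mpr hmul),
      mul_nonneg (show 0 ≤ n by linarith) hj]


/-- for every integer `k ≥ 4` and every odd prime `p`, the number
`d(p,k) = ((2k³−9k²+13k−6)p³ + (180−120k)p + 360)·p(p⁴−1)(p²−1) / 34560` is a
positive integer: `34560` divides the numerator and the numerator is positive. -/
theorem dim_is_positive_integer (k : ℤ) (hk : 4 ≤ k) (p : ℕ) (hp : p.Prime)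
    (hodd : Odd p) :
    (34560 : ℤ) ∣
        ((2 * k ^ 3 - 9 * k ^ 2 + 13 * k - 6) * (p : ℤ) ^ 3 + (180 - 120 * k) * (p : ℤ) + 360) *
          ((p : ℤ) * ((p : ℤ) ^ 4 - 1) * ((p : ℤ) ^ 2 - 1)) ∧
    0 <
        ((2 * k ^ 3 - 9 * k ^ 2 + 13 * k - 6) * (p : ℤ) ^ 3 + (180 - 120 * k) * (p : ℤ) + 360) *
          ((p : ℤ) * ((p : ℤ) ^ 4 - 1) * ((p : ℤ) ^ 2 - 1)) := by
  have hp3 : (3 : ℤ) ≤ p := by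
    obtain ⟨m, hm⟩ := hodd
    have := hp.two_le
    omega
  refine ⟨dvd_dim_numerator k (by exact_mod_cast hodd),
    mul_pos (dim_weight_factor_pos hk hp3) (mul_pos (mul_pos (by linarith) ?_) ?_)⟩ <;>
  exact sub_pos.mpr (one_lt_pow₀ (by linarith) (by norm_num))
end

section
/- For every prime p ≥ 5, the rational number I(p) = p²/576 + p/8 − 143/576 + (p/96 − 1/8)·χ(−1,p) + (1/8)·χ(2,p) + (1/12)·χ(3,p) + (p/36)·χ(−3,p), where χ(a,p) denotes the Legendre symbol (a/p) ∈ {1, −1}, is a nonnegative integer. -/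
/-- Ibukiyama's expression
`I(p) = p²/576 + p/8 − 143/576 + (p/96 − 1/8)(−1/p) + (1/8)(2/p) + (1/12)(3/p) + (p/36)(−3/p)`,
where `(a/p)` denotes the Legendre symbol. -/
noncomputable def ibukiyamaParamodularDim (p : ℕ) (hp : p.Prime) : ℚ :=
  letI : Fact p.Prime := ⟨hp⟩
  (p : ℚ) ^ 2 / 576 + (p : ℚ) / 8 - 143 / 576 +
    ((p : ℚ) / 96 - 1 / 8) * (legendreSym p (-1) : ℤ) +
    (1 / 8) * (legendreSym p 2 : ℤ) +
    (1 / 12) * (legendreSym p 3 : ℤ) +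
    ((p : ℚ) / 36) * (legendreSym p (-3) : ℤ)

/-- The quadratic character of `3` modulo a prime `p ≥ 5`. -/
theorem legendreSym_three_eq_if_mod_twelve (p : ℕ) [Fact p.Prime] (h5 : 5 ≤ p) :
    legendreSym p 3 = if p % 12 = 1 ∨ p % 12 = 11 then 1 else -1 := by
  have hp : p.Prime := Fact.out
  have h2 : ¬ 2 ∣ p := fun h => by
    have := (Nat.prime_dvd_prime_iff_eq Nat.prime_two hp).1 h
    omega
  have h3 : ¬ 3 ∣ p := fun h => by
    have := (Nat.prime_dvd_prime_iff_eq Nat.prime_three hp).1 h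
    omega
  have hrec : legendreSym p 3 = (-1) ^ (p / 2) * legendreSym 3 p := by
    simpa using legendreSym.quadratic_reciprocity' (p := 3) (q := p) (by norm_num) (by omega)
  have hone : legendreSym 3 1 = 1 := legendreSym.at_one 3
  have htwo : legendreSym 3 2 = -1 := by decide
  rw [hrec, legendreSym.mod 3 p]
  have hr : p % 12 = 1 ∨ p % 12 = 5 ∨ p % 12 = 7 ∨ p % 12 = 11 := by omega
  rcases hr with hr | hr | hr | hr
  · rw [show (p : ℤ) % (3 : ℕ) = 1 by omega, Even.neg_one_pow (Nat.even_iff.2 (by omega))]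
    simp [hr, hone]
  · rw [show (p : ℤ) % (3 : ℕ) = 2 by omega, Even.neg_one_pow (Nat.even_iff.2 (by omega))]
    simp [hr, htwo]
  · rw [show (p : ℤ) % (3 : ℕ) = 1 by omega, Odd.neg_one_pow (Nat.odd_iff.2 (by omega))]
    simp [hr, hone]
  · rw [show (p : ℤ) % (3 : ℕ) = 2 by omega, Odd.neg_one_pow (Nat.odd_iff.2 (by omega))]
    simp [hr, htwo]

/-- for every prime `p ≥ 5`, the rational number `I(p)` given by
Ibukiyama's formula is a nonnegative integer. -/
theorem ibukiyama_dim_is_nonneg_integer (p : ℕ) (hp : p.Prime) (h5 : 5 ≤ p) :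
    ∃ n : ℕ, ibukiyamaParamodularDim p hp = (n : ℚ) := by
  have : Fact p.Prime := ⟨hp⟩
  have h2 : ¬ 2 ∣ p := fun h => by
    have := (Nat.prime_dvd_prime_iff_eq Nat.prime_two hp).1 h
    omega
  have h3 : ¬ 3 ∣ p := fun h => by
    have := (Nat.prime_dvd_prime_iff_eq Nat.prime_three hp).1 h
    omega
  have hneg_three : legendreSym p (-3) = legendreSym p (-1) * legendreSym p 3 := by
    rw [← legendreSym.mul]
    norm_num
  simp only [ibukiyamaParamodularDim]
  rw [hneg_three, legendreSym_three_eq_if_mod_twelve p h5,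
    legendreSym.at_neg_one (by omega), legendreSym.at_two (by omega),
    ZMod.χ₄_nat_eq_if_mod_four, ZMod.χ₈_nat_eq_if_mod_eight]
  obtain ⟨k, r, hr, hpk⟩ : ∃ k r, (r = 1 ∨ r = 5 ∨ r = 7 ∨ r = 11 ∨ r = 13 ∨ r = 17 ∨
      r = 19 ∨ r = 23) ∧ p = 24 * k + r :=
    ⟨p / 24, p % 24, by omega, by omega⟩
  have h2' : p % 2 = p % 24 % 2 := by omega
  have h4 : p % 4 = p % 24 % 4 := by omega
  have h8 : p % 8 = p % 24 % 8 := by omega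
  have h12 : p % 12 = p % 24 % 12 := by omega
  have h24 : p % 24 = r := by omega
  have hq : (p : ℚ) = 24 * k + r := by exact_mod_cast hpk
  rw [h2', h4, h8, h12, h24, hq]
  rcases hr with rfl | rfl | rfl | rfl | rfl | rfl | rfl | rfl
  · exact ⟨k ^ 2 + 4 * k, by norm_num; ring⟩
  · exact ⟨k ^ 2 + 3 * k, by norm_num; ring⟩
  · exact ⟨k ^ 2 + 4 * k + 1, by norm_num; ring⟩
  · exact ⟨k ^ 2 + 3 * k + 1, by norm_num; ring⟩
  · exact ⟨k ^ 2 + 5 * k + 2, by norm_num; ring⟩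
  · exact ⟨k ^ 2 + 4 * k + 2, by norm_num; ring⟩
  · exact ⟨k ^ 2 + 5 * k + 3, by norm_num; ring⟩
  · exact ⟨k ^ 2 + 4 * k + 3, by norm_num; ring⟩
end
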